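/- arXiv:1706.07097 — 11 statements merged into one kernel-verified Lean document; each statement's English description precedes it below -/
import Mathlib

section
/- Define f : ℝ → ℝ by f(ξ) = inf{τ − y : τ ∈ ℝ, y ∈ {0,1}, y ≤ ξ and ξ ≤ τ}. Then sup{f(ξ) : ξ ∈ [0,1]} = 1, but f(ξ) < 1 for every ξ ∈ [0,1]; in particular the supremum over [0,1] is not attained. (This is the counterexample in Proposition A.1(ii) showing that the evaluation problem of a two-stage robust optimization problem may fail to attain its supremum even when only the constraint right-hand sides are uncertain.) -/
/-- On `[0, 1)` only `y = 0` is feasible, so the optimal value is `ξ`, attained at `τ = ξ`. -/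
theorem isLeast_feasible_of_lt_one {ξ : ℝ} (h0 : 0 ≤ ξ) (h1 : ξ < 1) :
    IsLeast {v : ℝ | ∃ τ : ℝ, ∃ y : ℝ,
      (y = 0 ∨ y = 1) ∧ y ≤ ξ ∧ ξ ≤ τ ∧ v = τ - y} ξ := by
  refine ⟨⟨ξ, 0, Or.inl rfl, h0, le_rfl, by ring⟩, ?_⟩
  rintro v ⟨τ, y, rfl | rfl, hy, hτ, rfl⟩ <;> linarith

/-- At `ξ = 1` the choice `y = 1` becomes feasible, and the optimal value drops to `0`. -/
theorem isLeast_feasible_one :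
    IsLeast {v : ℝ | ∃ τ : ℝ, ∃ y : ℝ,
      (y = 0 ∨ y = 1) ∧ y ≤ 1 ∧ 1 ≤ τ ∧ v = τ - y} 0 := by
  refine ⟨⟨1, 1, Or.inr rfl, le_rfl, le_rfl, by ring⟩, ?_⟩
  rintro v ⟨τ, y, rfl | rfl, hy, hτ, rfl⟩ <;> linarith

/-- Counterexample in Proposition A.1(ii): the evaluation problem of a two-stage robust
optimization problem may fail to attain its supremum even when only the constraint
right-hand sides are uncertain.  With
`f(ξ) = inf { τ − y : τ ∈ ℝ, y ∈ {0,1}, y ≤ ξ ≤ τ }`,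
we have `sup_{ξ ∈ [0,1]} f(ξ) = 1`, yet `f(ξ) < 1` for every `ξ ∈ [0,1]`. -/
theorem stmt1 (f : ℝ → ℝ)
    (hf : ∀ ξ, f ξ = sInf {v : ℝ | ∃ τ : ℝ, ∃ y : ℝ,
      (y = 0 ∨ y = 1) ∧ y ≤ ξ ∧ ξ ≤ τ ∧ v = τ - y}) :
    sSup (f '' Set.Icc (0 : ℝ) 1) = 1 ∧ ∀ ξ ∈ Set.Icc (0 : ℝ) 1, f ξ < 1 := by
  have hf_lt : ∀ ξ, 0 ≤ ξ → ξ < 1 → f ξ = ξ := fun ξ h0 h1 =>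
    (hf ξ).trans (isLeast_feasible_of_lt_one h0 h1).csInf_eq
  have hf_one : f 1 = 0 := (hf 1).trans isLeast_feasible_one.csInf_eq
  have hlt : ∀ ξ ∈ Set.Icc (0 : ℝ) 1, f ξ < 1 := by
    rintro ξ ⟨h0, h1⟩
    rcases h1.lt_or_eq with h | rfl
    · rwa [hf_lt ξ h0 h]
    · rw [hf_one]
      exact one_pos
  refine ⟨csSup_eq_of_forall_le_of_forall_lt_exists_gt ?_ ?_ ?_, hlt⟩
  · exact (Set.nonempty_Icc.2 zero_le_one).image f
  · rintro _ ⟨ξ, hξ, rfl⟩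
    exact (hlt ξ hξ).le
  · intro w hw
    obtain ⟨ξ, hmax, h1⟩ := exists_between (max_lt hw one_pos)
    obtain ⟨hwξ, h0⟩ := max_lt_iff.1 hmax
    exact ⟨ξ, ⟨ξ, ⟨h0.le, h1.le⟩, hf_lt ξ h0.le h1⟩, hwξ⟩
end

section
/- Let N₁, N₂, N_p, L be positive integers, X ⊆ ℝ^{N₁} nonempty and compact, Y ⊆ ℝ^{N₂} compact, Ξ ⊆ ℝ^{N_p} nonempty and compact, c ∈ ℝ^{N₁}, and let d : ℝ^{N_p} → ℝ^{N₂}, T : ℝ^{N_p} → ℝ^{L×N₁}, W : ℝ^{N_p} → ℝ^{L×N₂}, h : ℝ^{N_p} → ℝ^L be affine. Define Φ : ℝ^{N₁} → EReal by Φ(x) = ⟨c,x⟩ + sup_{ξ∈Ξ} inf{⟨d(ξ),y⟩ : y ∈ Y, T(ξ)x + W(ξ)y ≤ h(ξ)}, where the inner infimum equals +∞ if the feasible set is empty. Then Φ attains its infimum over X: there exists x* ∈ X with Φ(x*) ≤ Φ(x) for all x ∈ X. In particular, the two-stage robust optimization problem attains its infimum whenever it is feasible. (Proposition A.1(iii).)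 -/
open Matrix

/-- The value function of a parametric minimization over a compact set, with continuous objective
and closed constraint, is lower semicontinuous. -/
theorem lowerSemicontinuous_biInf_of_isCompact {α β γ : Type*} [TopologicalSpace α]
    [TopologicalSpace β] [CompleteLinearOrder γ] [DenselyOrdered γ] [TopologicalSpace γ]
    [OrderTopology γ] {K : Set β} (hK : IsCompact K) {C : Set (α × β)} (hC : IsClosed C)
    {f : β → γ} (hf : Continuous f) :
    LowerSemicontinuous fun x => ⨅ y ∈ {y ∈ K | (x, y) ∈ C}, f y := by
  intro x a hax
  obtain ⟨b, hab, hbx⟩ := exists_between hax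
  have hev : ∀ y ∈ K, ∀ᶠ z : α × β in nhds (x, y), z ∉ C ∨ b < f z.2 := by
    intro y hy
    have hU : IsOpen {z : α × β | z ∉ C ∨ b < f z.2} :=
      hC.isOpen_compl.union (isOpen_lt continuous_const (hf.comp continuous_snd))
    refine hU.mem_nhds ?_
    by_cases hxy : (x, y) ∈ C
    · exact Or.inr (hbx.trans_le (iInf₂_le y ⟨hy, hxy⟩))
    · exact Or.inl hxy
  filter_upwards [hK.eventually_forall_of_forall_eventually
    (P := fun x y => (x, y) ∉ C ∨ b < f y) hev] with x' hx'
  exact hab.trans_le <| le_iInf₂ fun y hy =>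
    ((hx' y hy.1).resolve_left (not_not_intro hy.2)).le

/-- Proposition A.1(iii): the two-stage robust optimization problem attains its infimum
over the nonempty compact set `X` (in particular, it attains its infimum whenever it is
feasible).  Here `Φ(x) = ⟨c,x⟩ + sup_{ξ∈Ξ} inf{⟨d(ξ),y⟩ : y ∈ Y, T(ξ)x + W(ξ)y ≤ h(ξ)}`,
with the inner infimum equal to `+∞` (in `EReal`) when the feasible set is empty. -/
theorem stmt2 (N₁ N₂ Np L : ℕ) (hN₁ : 0 < N₁) (hN₂ : 0 < N₂) (hNp : 0 < Np) (hL : 0 < L)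
    (X : Set (Fin N₁ → ℝ)) (hXne : X.Nonempty) (hXc : IsCompact X)
    (Y : Set (Fin N₂ → ℝ)) (hYc : IsCompact Y)
    (Ξ : Set (Fin Np → ℝ)) (hΞne : Ξ.Nonempty) (hΞc : IsCompact Ξ)
    (c : Fin N₁ → ℝ)
    (d : (Fin Np → ℝ) → (Fin N₂ → ℝ))
    (T : (Fin Np → ℝ) → Matrix (Fin L) (Fin N₁) ℝ)
    (W : (Fin Np → ℝ) → Matrix (Fin L) (Fin N₂) ℝ)
    (h : (Fin Np → ℝ) → (Fin L → ℝ))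
    (hd : ∃ (d₀ : Fin N₂ → ℝ) (D : (Fin Np → ℝ) →ₗ[ℝ] (Fin N₂ → ℝ)), ∀ ξ, d ξ = d₀ + D ξ)
    (hT : ∃ (T₀ : Matrix (Fin L) (Fin N₁) ℝ)
      (Tl : (Fin Np → ℝ) →ₗ[ℝ] Matrix (Fin L) (Fin N₁) ℝ), ∀ ξ, T ξ = T₀ + Tl ξ)
    (hW : ∃ (W₀ : Matrix (Fin L) (Fin N₂) ℝ)
      (Wl : (Fin Np → ℝ) →ₗ[ℝ] Matrix (Fin L) (Fin N₂) ℝ), ∀ ξ, W ξ = W₀ + Wl ξ)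
    (hh : ∃ (h₀ : Fin L → ℝ) (hl : (Fin Np → ℝ) →ₗ[ℝ] (Fin L → ℝ)), ∀ ξ, h ξ = h₀ + hl ξ)
    (Φ : (Fin N₁ → ℝ) → EReal)
    (hΦ : ∀ x, Φ x = ((c ⬝ᵥ x : ℝ) : EReal) +
      ⨆ ξ ∈ Ξ, ⨅ y ∈ {y ∈ Y | T ξ *ᵥ x + W ξ *ᵥ y ≤ h ξ}, ((d ξ ⬝ᵥ y : ℝ) : EReal)) :
    ∃ xs ∈ X, ∀ x ∈ X, Φ xs ≤ Φ x := by
  have hΦ_lsc : LowerSemicontinuous Φ := by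
    rw [funext hΦ]
    refine LowerSemicontinuous.add'
      (continuous_coe_real_ereal.comp (by fun_prop : Continuous fun x => c ⬝ᵥ x)).lowerSemicontinuous
      (lowerSemicontinuous_biSup fun ξ _ => ?_)
      fun x => EReal.continuousAt_add (by simp) (by simp)
    have hC : IsClosed {p : (Fin N₁ → ℝ) × (Fin N₂ → ℝ) | T ξ *ᵥ p.1 + W ξ *ᵥ p.2 ≤ h ξ} :=
      isClosed_le (by fun_prop) continuous_const
    exact lowerSemicontinuous_biInf_of_isCompact hYc hC
      (continuous_coe_real_ereal.comp (by fun_prop : Continuous fun y => d ξ ⬝ᵥ y))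
  obtain ⟨xs, hxs, hmin⟩ := (hΦ_lsc.lowerSemicontinuousOn X).exists_isMinOn hXne hXc
  exact ⟨xs, hxs, fun x hx => hmin hx⟩
end

section
/- Let n ≥ 1, let A be a real R×n matrix and b ∈ ℝ^R, and suppose the set F = {ξ ∈ [0,1]^n : Aξ ≤ b} is nonempty. Define for ξ ∈ ℝ^n the inner value q(ξ) = inf{∑_{i=1}^n y_i : y ∈ ℝ^n, y_i ≥ ξ_i − 1/2 and y_i ≥ 1/2 − ξ_i for all i}. Then sup_{ξ ∈ F} q(ξ) = n/2 if and only if there exists ξ ∈ {0,1}^n with Aξ ≤ b. (This is the reduction underlying Proposition A.3(ii), based on the facts that q(ξ) = ‖ξ − (1/2)𝟙‖₁, that ‖ξ − (1/2)𝟙‖₁ ≤ n/2 for all ξ ∈ [0,1]^n, and that equality holds exactly when ξ ∈ {0,1}^n.) -/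
open Matrix

/-- The least value of `∑ yᵢ` over `yᵢ ≥ |ξᵢ - c|`, with the absolute value split into two linear
constraints, is the `ℓ₁`-distance from `ξ` to the constant vector `c`. -/
theorem sInf_sum_epigraph_abs_sub {ι : Type*} [Fintype ι] (ξ : ι → ℝ) (c : ℝ) :
    sInf {s : ℝ | ∃ y : ι → ℝ, (∀ i, ξ i - c ≤ y i ∧ c - ξ i ≤ y i) ∧ s = ∑ i, y i} =
      ∑ i, |ξ i - c| := by
  refine IsLeast.csInf_eq ⟨⟨fun i => |ξ i - c|, fun i => ⟨le_abs_self _, ?_⟩, rfl⟩, ?_⟩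
  · exact (le_abs_self _).trans_eq (abs_sub_comm _ _)
  · rintro s ⟨y, hy, rfl⟩
    exact Finset.sum_le_sum fun i _ => abs_le'.2 ⟨(hy i).1, by linarith [(hy i).2]⟩

theorem abs_sub_half_le_half {x : ℝ} (hx : x ∈ Set.Icc (0 : ℝ) 1) : |x - 1 / 2| ≤ 1 / 2 :=
  abs_le.2 ⟨by linarith [hx.1], by linarith [hx.2]⟩

theorem abs_sub_half_eq_half_iff {x : ℝ} : |x - 1 / 2| = 1 / 2 ↔ x = 0 ∨ x = 1 := by
  rw [abs_eq (by norm_num)]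
  constructor
  · rintro (h | h)
    · exact Or.inr (by linarith)
    · exact Or.inl (by linarith)
  · rintro (rfl | rfl) <;> norm_num

theorem sum_abs_sub_half_le {n : ℕ} {ξ : Fin n → ℝ} (hξ : ∀ i, ξ i ∈ Set.Icc (0 : ℝ) 1) :
    ∑ i, |ξ i - 1 / 2| ≤ n / 2 :=
  (Finset.sum_le_sum fun i _ => abs_sub_half_le_half (hξ i)).trans_eq (by simp [div_eq_mul_inv])

theorem sum_abs_sub_half_eq_iff {n : ℕ} {ξ : Fin n → ℝ}
    (hξ : ∀ i, ξ i ∈ Set.Icc (0 : ℝ) 1) :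
    ∑ i, |ξ i - 1 / 2| = n / 2 ↔ ∀ i, ξ i = 0 ∨ ξ i = 1 := by
  have hconst : (n / 2 : ℝ) = ∑ _i : Fin n, (1 / 2 : ℝ) := by simp [div_eq_mul_inv]
  rw [hconst, Finset.sum_eq_sum_iff_of_le fun i _ => abs_sub_half_le_half (hξ i)]
  simp only [Finset.mem_univ, true_implies, abs_sub_half_eq_half_iff]

theorem isCompact_unitCube_inter_mulVec_le {n R : ℕ} (A : Matrix (Fin R) (Fin n) ℝ)
    (b : Fin R → ℝ) :
    IsCompact {ξ : Fin n → ℝ | (∀ i, ξ i ∈ Set.Icc (0 : ℝ) 1) ∧ A *ᵥ ξ ≤ b} := by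
  have hcube : IsCompact {ξ : Fin n → ℝ | ∀ i, ξ i ∈ Set.Icc (0 : ℝ) 1} :=
    isCompact_pi_infinite fun _ => isCompact_Icc
  exact hcube.inter_right
    (isClosed_le (Continuous.matrix_mulVec continuous_const continuous_id) continuous_const)

/-- The reduction underlying Proposition A.3(ii): with
`q(ξ) = inf{∑ᵢ yᵢ : y ∈ ℝⁿ, yᵢ ≥ ξᵢ − 1/2, yᵢ ≥ 1/2 − ξᵢ}` and
`F = {ξ ∈ [0,1]ⁿ : Aξ ≤ b}` nonempty, we have `sup_{ξ ∈ F} q(ξ) = n/2` if and only if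
there exists `ξ ∈ {0,1}ⁿ` with `Aξ ≤ b`. -/
theorem stmt5 (n R : ℕ) (hn : 1 ≤ n)
    (A : Matrix (Fin R) (Fin n) ℝ) (b : Fin R → ℝ)
    (F : Set (Fin n → ℝ))
    (hF : F = {ξ | (∀ i, ξ i ∈ Set.Icc (0 : ℝ) 1) ∧ A *ᵥ ξ ≤ b})
    (hFne : F.Nonempty)
    (q : (Fin n → ℝ) → ℝ)
    (hq : ∀ ξ, q ξ = sInf {s : ℝ | ∃ y : Fin n → ℝ,
      (∀ i, ξ i - 1 / 2 ≤ y i ∧ 1 / 2 - ξ i ≤ y i) ∧ s = ∑ i, y i}) :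
    sSup (q '' F) = n / 2 ↔
      ∃ ξ : Fin n → ℝ, (∀ i, ξ i = 0 ∨ ξ i = 1) ∧ A *ᵥ ξ ≤ b := by
  have hq' : ∀ ξ, q ξ = ∑ i, |ξ i - 1 / 2| := fun ξ =>
    (hq ξ).trans (sInf_sum_epigraph_abs_sub ξ (1 / 2))
  have hcont : Continuous q := by
    rw [funext hq']
    fun_prop
  subst hF
  constructor
  · intro h
    obtain ⟨ξ, hξ, hsup⟩ :=
      (isCompact_unitCube_inter_mulVec_le A b).exists_sSup_image_eq hFne hcont.continuousOn
    rw [h, hq'] at hsup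
    exact ⟨ξ, (sum_abs_sub_half_eq_iff hξ.1).1 hsup.symm, hξ.2⟩
  · rintro ⟨ξ, hξ, hA⟩
    have hmem : ∀ i, ξ i ∈ Set.Icc (0 : ℝ) 1 := fun i => by
      rcases hξ i with h | h <;> simp [h]
    refine IsGreatest.csSup_eq ⟨⟨ξ, ⟨hmem, hA⟩, ?_⟩, ?_⟩
    · rw [hq', (sum_abs_sub_half_eq_iff hmem).2 hξ]
    · rintro _ ⟨η, hη, rfl⟩
      rw [hq']
      exact sum_abs_sub_half_le hη.1
end

section
/- Let N₁, N₂, N_p, L be positive integers, X ⊆ ℝ^{N₁} nonempty and compact, Y ⊆ ℝ^{N₂} nonempty, compact and convex, Ξ ⊆ ℝ^{N_p} nonempty, compact and convex, c ∈ ℝ^{N₁}, d : ℝ^{N_p} → ℝ^{N₂} affine, and T ∈ ℝ^{L×N₁}, W ∈ ℝ^{L×N₂}, h ∈ ℝ^L fixed (deterministic constraints). Then the two-stage robust optimization value equals the static robust optimization value: inf_{x∈X} sup_{ξ∈Ξ} inf{⟨c,x⟩ + ⟨d(ξ),y⟩ : y ∈ Y, Tx + Wy ≤ h} = inf{ sup_{ξ∈Ξ}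 (⟨c,x⟩ + ⟨d(ξ),y⟩) : x ∈ X, y ∈ Y, Tx + Wy ≤ h }, where both sides are extended reals and infima over empty sets equal +∞. (Proposition A.4: with convex Ξ and uncertainty only in the objective, the two-stage problem over a convex recourse set reduces to a static robust optimization problem.) -/
open Matrix

/-- Minimax theorem for real-valued functions that are continuous and convex-concave, with the
values taken in `EReal`. The minimization set may be empty. -/
theorem iInf_iSup_coe_eq_iSup_iInf {E F : Type*}
    [TopologicalSpace E] [AddCommGroup E] [Module ℝ E] [IsTopologicalAddGroup E]
    [ContinuousSMul ℝ E] [TopologicalSpace F] [AddCommGroup F] [Module ℝ F]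
    [IsTopologicalAddGroup F] [ContinuousSMul ℝ F]
    {A : Set E} {B : Set F} {f : E → F → ℝ}
    (cA : Convex ℝ A) (kA : IsCompact A) (cB : Convex ℝ B) (hB : B.Nonempty)
    (hf₁ : ∀ y ∈ B, ContinuousOn (fun x ↦ f x y) A) (hf₁' : ∀ y ∈ B, ConvexOn ℝ A (fun x ↦ f x y))
    (hf₂ : ∀ x ∈ A, ContinuousOn (f x) B) (hf₂' : ∀ x ∈ A, ConcaveOn ℝ B (f x)) :
    ⨅ x ∈ A, ⨆ y ∈ B, (f x y : EReal) = ⨆ y ∈ B, ⨅ x ∈ A, (f x y : EReal) := by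
  rcases A.eq_empty_or_nonempty with rfl | hA
  · simp [biSup_const hB]
  · exact Sion.minimax' (f := fun x y ↦ (f x y : EReal)) hA cA kA
      (fun y hy ↦ (continuous_coe_real_ereal.comp_continuousOn (hf₁ y hy)).lowerSemicontinuousOn)
      (fun y hy ↦ (hf₁' y hy).quasiconvexOn.monotone_comp (g := Real.toEReal)
        EReal.coe_strictMono.monotone) cB
      (fun x hx ↦ (continuous_coe_real_ereal.comp_continuousOn (hf₂ x hx)).upperSemicontinuousOn)
      (fun x hx ↦ (hf₂' x hx).quasiconcaveOn.monotone_comp (g := Real.toEReal)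
        EReal.coe_strictMono.monotone)

theorem convex_setOf_add_mulVec_le {m n : Type*} [Fintype n] {Y : Set (n → ℝ)} (hY : Convex ℝ Y)
    (W : Matrix m n ℝ) (b h : m → ℝ) : Convex ℝ {y ∈ Y | b + W *ᵥ y ≤ h} := by
  have : {y ∈ Y | b + W *ᵥ y ≤ h} = Y ∩ W.mulVecLin ⁻¹' Set.Iic (h - b) := by
    ext y
    simp [le_sub_iff_add_le']
  rw [this]
  exact hY.inter ((convex_Iic (𝕜 := ℝ) _).linear_preimage _)

theorem isCompact_setOf_add_mulVec_le {m n : Type*} [Fintype n] {Y : Set (n → ℝ)}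
    (hY : IsCompact Y) (W : Matrix m n ℝ) (b h : m → ℝ) :
    IsCompact {y ∈ Y | b + W *ᵥ y ≤ h} :=
  hY.inter_right (isClosed_le
    (continuous_const.add (continuous_const.matrix_mulVec continuous_id)) continuous_const)

/-- Proposition A.4: with convex compact `Ξ`, convex compact `Y`, uncertainty only in the
objective (affine `d`), and deterministic constraints `Tx + Wy ≤ h`, the two-stage robust
optimization value equals the static robust optimization value (values in `EReal`,
infima over empty sets equal `+∞`). -/
theorem stmt6 (N₁ N₂ Np L : ℕ) (hN₁ : 0 < N₁) (hN₂ : 0 < N₂) (hNp : 0 < Np) (hL : 0 < L)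
    (X : Set (Fin N₁ → ℝ)) (hXne : X.Nonempty) (hXc : IsCompact X)
    (Y : Set (Fin N₂ → ℝ)) (hYne : Y.Nonempty) (hYc : IsCompact Y) (hYconv : Convex ℝ Y)
    (Ξ : Set (Fin Np → ℝ)) (hΞne : Ξ.Nonempty) (hΞc : IsCompact Ξ) (hΞconv : Convex ℝ Ξ)
    (c : Fin N₁ → ℝ)
    (d : (Fin Np → ℝ) → (Fin N₂ → ℝ))
    (hd : ∃ (d₀ : Fin N₂ → ℝ) (D : (Fin Np → ℝ) →ₗ[ℝ] (Fin N₂ → ℝ)), ∀ ξ, d ξ = d₀ + D ξ)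
    (T : Matrix (Fin L) (Fin N₁) ℝ) (W : Matrix (Fin L) (Fin N₂) ℝ) (h : Fin L → ℝ) :
    (⨅ x ∈ X, ⨆ ξ ∈ Ξ, ⨅ y ∈ {y ∈ Y | T *ᵥ x + W *ᵥ y ≤ h},
        ((c ⬝ᵥ x + d ξ ⬝ᵥ y : ℝ) : EReal)) =
      ⨅ x ∈ X, ⨅ y ∈ {y ∈ Y | T *ᵥ x + W *ᵥ y ≤ h}, ⨆ ξ ∈ Ξ,
        ((c ⬝ᵥ x + d ξ ⬝ᵥ y : ℝ) : EReal) := by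
  obtain ⟨d₀, D, hd⟩ := hd
  obtain rfl : d = fun ξ ↦ d₀ + D ξ := funext hd
  refine biInf_congr fun x _ ↦ (iInf_iSup_coe_eq_iSup_iInf
    (convex_setOf_add_mulVec_le hYconv W _ h) (isCompact_setOf_add_mulVec_le hYc W _ h)
    hΞconv hΞne ?_ ?_ ?_ ?_).symm
  · intro ξ _
    fun_prop
  · intro ξ _
    refine ⟨convex_setOf_add_mulVec_le hYconv W _ h, fun y _ z _ a b _ _ hab ↦ le_of_eq ?_⟩
    simp only [dotProduct_add, dotProduct_smul, smul_eq_mul]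
    linear_combination (-(c ⬝ᵥ x)) * hab
  · intro y _
    have hD : Continuous D := D.continuous_of_finiteDimensional
    fun_prop
  · intro y _
    refine ⟨hΞconv, fun ξ _ η _ a b _ _ hab ↦ le_of_eq ?_⟩
    simp only [map_add, map_smul, add_dotProduct, smul_dotProduct, smul_eq_mul]
    linear_combination (c ⬝ᵥ x + d₀ ⬝ᵥ y) * hab
end

section
/- Let N₁, N₂, N_p, L be positive integers, X ⊆ ℝ^{N₁} nonempty, Ξ ⊆ ℝ^{N_p} nonempty, c ∈ ℝ^{N₁}, d ∈ ℝ^{N₂} and W ∈ ℝ^{L×N₂} fixed (deterministic objective and fixed recourse), and let T : ℝ^{N_p} → ℝ^{L×N₁} and h : ℝ^{N_p} → ℝ^L be affine. For an integer K ≥ 1, a piecewise affine decision rule with K pieces is a function y : Ξ → ℝ^{N₂} for which there exist pairs (y_k⁰, Y_k) ∈ ℝ^{N₂} × ℝ^{N₂×N_p}, k = 1,…,K, such that for every ξ ∈ Ξ there is some k with y(ξ) = y_k⁰ + Y_k ξ. Then the following two extended-real values are equal: (i) the infimum, over all x ∈ X and all piecewise affine decision rules y with K pieces satisfying T(ξ)x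 + W y(ξ) ≤ h(ξ) for all ξ ∈ Ξ, of sup_{ξ∈Ξ} (⟨c,x⟩ + ⟨d, y(ξ)⟩); and (ii) the infimum, over all x ∈ X and all K-tuples (y_k⁰, Y_k)_{k=1}^K ∈ (ℝ^{N₂} × ℝ^{N₂×N_p})^K, of sup_{ξ∈Ξ} min{⟨c,x⟩ + ⟨d, y_k⁰ + Y_k ξ⟩ : k ∈ {1,…,K}, T(ξ)x + W(y_k⁰ + Y_k ξ) ≤ h(ξ)}, where the minimum over an empty index set equals +∞. (This is Observation 1: the piecewise affine decision rule problem with fixed recourse is equivalent to a K-adaptability problem.) -/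
open Matrix

/-- Observation 1: the piecewise affine decision rule problem with fixed recourse `W`,
deterministic objective `d` and `K` pieces is equivalent to the corresponding
`K`-adaptability problem: the two extended-real optimal values coincide
(infima over empty sets and minima over empty index sets equal `+∞`). -/
theorem stmt8 (N₁ N₂ Np L K : ℕ) (hN₁ : 0 < N₁) (hN₂ : 0 < N₂) (hNp : 0 < Np) (hL : 0 < L)
    (hK : 1 ≤ K)
    (X : Set (Fin N₁ → ℝ)) (hXne : X.Nonempty)
    (Ξ : Set (Fin Np → ℝ)) (hΞne : Ξ.Nonempty)
    (c : Fin N₁ → ℝ) (d : Fin N₂ → ℝ) (W : Matrix (Fin L) (Fin N₂) ℝ)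
    (T : (Fin Np → ℝ) → Matrix (Fin L) (Fin N₁) ℝ)
    (h : (Fin Np → ℝ) → (Fin L → ℝ))
    (hT : ∃ (T₀ : Matrix (Fin L) (Fin N₁) ℝ)
      (Tl : (Fin Np → ℝ) →ₗ[ℝ] Matrix (Fin L) (Fin N₁) ℝ), ∀ ξ, T ξ = T₀ + Tl ξ)
    (hh : ∃ (h₀ : Fin L → ℝ) (hl : (Fin Np → ℝ) →ₗ[ℝ] (Fin L → ℝ)), ∀ ξ, h ξ = h₀ + hl ξ) :
    sInf {v : EReal | ∃ x ∈ X, ∃ y : (Fin Np → ℝ) → (Fin N₂ → ℝ),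
        (∃ p : Fin K → (Fin N₂ → ℝ) × Matrix (Fin N₂) (Fin Np) ℝ,
          ∀ ξ ∈ Ξ, ∃ k : Fin K, y ξ = (p k).1 + (p k).2 *ᵥ ξ) ∧
        (∀ ξ ∈ Ξ, T ξ *ᵥ x + W *ᵥ y ξ ≤ h ξ) ∧
        v = ⨆ ξ ∈ Ξ, ((c ⬝ᵥ x + d ⬝ᵥ y ξ : ℝ) : EReal)} =
      sInf {v : EReal | ∃ x ∈ X, ∃ p : Fin K → (Fin N₂ → ℝ) × Matrix (Fin N₂) (Fin Np) ℝ,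
        v = ⨆ ξ ∈ Ξ,
          ⨅ k ∈ {k : Fin K | T ξ *ᵥ x + W *ᵥ ((p k).1 + (p k).2 *ᵥ ξ) ≤ h ξ},
            ((c ⬝ᵥ x + d ⬝ᵥ ((p k).1 + (p k).2 *ᵥ ξ) : ℝ) : EReal)} := by
  apply le_antisymm
  · refine le_sInf ?_
    rintro v ⟨x, hx, p, rfl⟩
    by_cases hfeas : ∀ ξ ∈ Ξ, ∃ k : Fin K, T ξ *ᵥ x + W *ᵥ ((p k).1 + (p k).2 *ᵥ ξ) ≤ h ξ
    · have hmin : ∀ ξ, ∃ k : Fin K, ξ ∈ Ξ →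
          T ξ *ᵥ x + W *ᵥ ((p k).1 + (p k).2 *ᵥ ξ) ≤ h ξ ∧
          ∀ j : Fin K, T ξ *ᵥ x + W *ᵥ ((p j).1 + (p j).2 *ᵥ ξ) ≤ h ξ →
            c ⬝ᵥ x + d ⬝ᵥ ((p k).1 + (p k).2 *ᵥ ξ) ≤
              c ⬝ᵥ x + d ⬝ᵥ ((p j).1 + (p j).2 *ᵥ ξ) := by
        intro ξ
        by_cases hξ : ξ ∈ Ξ
        · obtain ⟨k, hk, hkmin⟩ := Set.exists_min_image
            {k : Fin K | T ξ *ᵥ x + W *ᵥ ((p k).1 + (p k).2 *ᵥ ξ) ≤ h ξ}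
            (fun k => c ⬝ᵥ x + d ⬝ᵥ ((p k).1 + (p k).2 *ᵥ ξ)) (Set.toFinite _) (hfeas ξ hξ)
          exact ⟨k, fun _ => ⟨hk, hkmin⟩⟩
        · exact ⟨⟨0, hK⟩, fun hmem => absurd hmem hξ⟩
      choose k hk using hmin
      refine sInf_le_of_le ⟨x, hx, fun ξ => (p (k ξ)).1 + (p (k ξ)).2 *ᵥ ξ,
        ⟨p, fun ξ _ => ⟨k ξ, rfl⟩⟩, fun ξ hξ => (hk ξ hξ).1, rfl⟩ ?_
      exact iSup₂_mono fun ξ hξ => le_iInf₂ fun j hj =>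
        EReal.coe_le_coe_iff.2 ((hk ξ hξ).2 j hj)
    · push Not at hfeas
      obtain ⟨ξ, hξ, hinf⟩ := hfeas
      refine le_trans ?_ (le_iSup₂ ξ hξ)
      exact le_iInf₂ fun j hj => absurd hj (hinf j)
  · refine le_sInf ?_
    rintro v ⟨x, hx, y, ⟨p, hp⟩, hy, rfl⟩
    refine sInf_le_of_le ⟨x, hx, p, rfl⟩ (iSup₂_mono fun ξ hξ => ?_)
    obtain ⟨k, hk⟩ := hp ξ hξ
    have hfeas := hy ξ hξ
    rw [hk] at hfeas ⊢
    exact iInf₂_le k hfeas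
end

section
/- Let N₁, N₂, N_p, L be positive integers, K ≥ 1 an integer, Ξ ⊆ ℝ^{N_p} nonempty and compact, c ∈ ℝ^{N₁}, and let d : ℝ^{N_p} → ℝ^{N₂}, t_l : ℝ^{N_p} → ℝ^{N₁}, w_l : ℝ^{N_p} → ℝ^{N₂}, h_l : ℝ^{N_p} → ℝ (l = 1,…,L) be affine. Define S(θ, x, y, ξ) = min_{k∈{1,…,K}} max( ⟨c,x⟩ + ⟨d(ξ), y_k⟩ − θ, max_{l∈{1,…,L}} (⟨t_l(ξ), x⟩ + ⟨w_l(ξ), y_k⟩ − h_l(ξ)) ) for (θ, x, y, ξ) ∈ ℝ × ℝ^{N₁} × (ℝ^{N₂})^K × Ξ. Suppose (θ^ℓ, x^ℓ, y^ℓ)_{ℓ∈ℕ} is a sequence in ℝ × ℝ^{N₁} × (ℝ^{N₂})^K and (ξ^ℓ)_{ℓ∈ℕ} a sequence in Ξ such that: (a) for every ℓ, ξ^ℓ maximizes S(θ^ℓ, x^ℓ, y^ℓ, ·) over Ξ; (b) for all ℓ' > ℓ, S(θ^{ℓ'}, x^{ℓ'}, y^{ℓ'}, ξ^ℓ) ≤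 0; and (c) (θ^ℓ, x^ℓ, y^ℓ) converges to (θ̂, x̂, ŷ) along some strictly increasing subsequence. Then S(θ̂, x̂, ŷ, ξ) ≤ 0 for every ξ ∈ Ξ; that is, every accumulation point is feasible for the semi-infinite disjunctive reformulation of the K-adaptability problem with objective value at most θ̂. (This is the core feasibility claim in the proof of Theorem 2, the asymptotic convergence of the branch-and-bound scheme.) -/
open Matrix Filter

/-- An affine map from `Fin n → ℝ` to a real topological vector space is continuous. -/
theorem continuous_of_eq_add_linearMap {n : ℕ} {F : Type*} [AddCommGroup F] [Module ℝ F]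
    [TopologicalSpace F] [IsTopologicalAddGroup F] [ContinuousSMul ℝ F]
    {f : (Fin n → ℝ) → F}
    (hf : ∃ (f₀ : F) (A : (Fin n → ℝ) →ₗ[ℝ] F), ∀ ξ, f ξ = f₀ + A ξ) : Continuous f := by
  obtain ⟨f₀, A, hA⟩ := hf
  rw [funext hA]
  exact continuous_const.add A.continuous_of_finiteDimensional

/-- Let `g` be jointly continuous and `p` converge. If each `ξ m` maximizes `g (p m) ·` over the
compact set `s` and `g (p n) (ξ m) ≤ 0` for `m < n`, then `g (lim p) ≤ 0` on `s`. -/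
theorem le_zero_of_tendsto_of_isMaxOn {P X : Type*} [TopologicalSpace P] [TopologicalSpace X]
    [FirstCountableTopology X] {g : P → X → ℝ} (hg : Continuous fun q : P × X => g q.1 q.2)
    {s : Set X} (hs : IsCompact s) {p : ℕ → P} {a : P} (hp : Tendsto p atTop (nhds a))
    {ξ : ℕ → X} (hξ : ∀ m, ξ m ∈ s) (hmax : ∀ m, IsMaxOn (g (p m)) s (ξ m))
    (hle : ∀ m n, m < n → g (p n) (ξ m) ≤ 0) : ∀ x ∈ s, g a x ≤ 0 := by
  intro x hx
  obtain ⟨z, -, ψ, hψ, hz⟩ := hs.tendsto_subseq hξ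
  have hpψ : Tendsto (fun m => p (ψ m)) atTop (nhds a) := hp.comp hψ.tendsto_atTop
  have hlim {q : ℕ → P} {y : ℕ → X} {b : X} (hq : Tendsto q atTop (nhds a))
      (hy : Tendsto y atTop (nhds b)) :
      Tendsto (fun m => g (q m) (y m)) atTop (nhds (g a b)) :=
    (hg.tendsto (a, b)).comp (hq.prodMk_nhds hy)
  calc g a x ≤ g a z :=
        le_of_tendsto_of_tendsto' (hlim hpψ tendsto_const_nhds) (hlim hpψ hz)
          fun m => hmax (ψ m) hx
    _ ≤ 0 :=
        le_of_tendsto' (hlim (hpψ.comp (tendsto_add_atTop_nat 1)) hz)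
          fun m => hle _ _ (hψ m.lt_succ_self)

/-- Core feasibility claim in the proof of Theorem 2 (asymptotic convergence of the
branch-and-bound scheme): if at every iteration `ℓ` the scenario `ξ^ℓ` maximizes the
separation function `S(θ^ℓ, x^ℓ, y^ℓ, ·)` over `Ξ`, all later iterates satisfy
`S(θ^{ℓ'}, x^{ℓ'}, y^{ℓ'}, ξ^ℓ) ≤ 0`, and `(θ^ℓ, x^ℓ, y^ℓ)` converges to
`(θ̂, x̂, ŷ)` along a subsequence, then `S(θ̂, x̂, ŷ, ξ) ≤ 0` for every `ξ ∈ Ξ`. -/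
theorem stmt11 (N₁ N₂ Np L K : ℕ) (hN₁ : 0 < N₁) (hN₂ : 0 < N₂) (hNp : 0 < Np)
    (hL : 0 < L) (hK : 0 < K)
    (Ξ : Set (Fin Np → ℝ)) (hΞne : Ξ.Nonempty) (hΞc : IsCompact Ξ)
    (c : Fin N₁ → ℝ)
    (d : (Fin Np → ℝ) → (Fin N₂ → ℝ))
    (t : Fin L → (Fin Np → ℝ) → (Fin N₁ → ℝ))
    (w : Fin L → (Fin Np → ℝ) → (Fin N₂ → ℝ))
    (h : Fin L → (Fin Np → ℝ) → ℝ)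
    (hd : ∃ (d₀ : Fin N₂ → ℝ) (D : (Fin Np → ℝ) →ₗ[ℝ] (Fin N₂ → ℝ)), ∀ ξ, d ξ = d₀ + D ξ)
    (ht : ∀ l, ∃ (t₀ : Fin N₁ → ℝ) (tl : (Fin Np → ℝ) →ₗ[ℝ] (Fin N₁ → ℝ)),
      ∀ ξ, t l ξ = t₀ + tl ξ)
    (hw : ∀ l, ∃ (w₀ : Fin N₂ → ℝ) (wl : (Fin Np → ℝ) →ₗ[ℝ] (Fin N₂ → ℝ)),
      ∀ ξ, w l ξ = w₀ + wl ξ)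
    (hh : ∀ l, ∃ (h₀ : ℝ) (hl : (Fin Np → ℝ) →ₗ[ℝ] ℝ), ∀ ξ, h l ξ = h₀ + hl ξ)
    (S : ℝ → (Fin N₁ → ℝ) → (Fin K → Fin N₂ → ℝ) → (Fin Np → ℝ) → ℝ)
    (hS : ∀ θ x y ξ, S θ x y ξ = Finset.inf' Finset.univ ⟨⟨0, hK⟩, Finset.mem_univ _⟩
      (fun k => max (c ⬝ᵥ x + d ξ ⬝ᵥ y k - θ)
        (Finset.sup' Finset.univ ⟨⟨0, hL⟩, Finset.mem_univ _⟩
          (fun l => t l ξ ⬝ᵥ x + w l ξ ⬝ᵥ y k - h l ξ))))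
    (θseq : ℕ → ℝ) (xseq : ℕ → Fin N₁ → ℝ) (yseq : ℕ → Fin K → Fin N₂ → ℝ)
    (ξseq : ℕ → Fin Np → ℝ) (hξmem : ∀ ℓ, ξseq ℓ ∈ Ξ)
    (hmax : ∀ ℓ, ∀ ξ ∈ Ξ,
      S (θseq ℓ) (xseq ℓ) (yseq ℓ) ξ ≤ S (θseq ℓ) (xseq ℓ) (yseq ℓ) (ξseq ℓ))
    (hfeas : ∀ ℓ ℓ' : ℕ, ℓ < ℓ' → S (θseq ℓ') (xseq ℓ') (yseq ℓ') (ξseq ℓ) ≤ 0)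
    (θhat : ℝ) (xhat : Fin N₁ → ℝ) (yhat : Fin K → Fin N₂ → ℝ)
    (hconv : ∃ φ : ℕ → ℕ, StrictMono φ ∧
      Tendsto (fun m => (θseq (φ m), xseq (φ m), yseq (φ m))) atTop
        (nhds (θhat, xhat, yhat))) :
    ∀ ξ ∈ Ξ, S θhat xhat yhat ξ ≤ 0 := by
  obtain ⟨φ, hφ, hlim⟩ := hconv
  have hdc := continuous_of_eq_add_linearMap hd
  have htc := fun l => continuous_of_eq_add_linearMap (ht l)
  have hwc := fun l => continuous_of_eq_add_linearMap (hw l)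
  have hhc := fun l => continuous_of_eq_add_linearMap (hh l)
  have hcont : Continuous fun q : (ℝ × (Fin N₁ → ℝ) × (Fin K → Fin N₂ → ℝ)) × (Fin Np → ℝ) =>
      S q.1.1 q.1.2.1 q.1.2.2 q.2 := by
    simp only [hS]
    refine Continuous.finset_inf'_apply _ fun k _ => Continuous.max ?_ ?_
    · fun_prop
    · refine Continuous.finset_sup'_apply _ fun l _ => ?_
      have := htc l
      have := hwc l
      have := hhc l
      fun_prop
  exact le_zero_of_tendsto_of_isMaxOn
    (g := fun (q : ℝ × (Fin N₁ → ℝ) × (Fin K → Fin N₂ → ℝ)) => S q.1 q.2.1 q.2.2)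
    hcont hΞc hlim (fun m => hξmem (φ m)) (fun m => isMaxOn_iff.2 (hmax (φ m)))
    fun m n hmn => hfeas _ _ (hφ hmn)
end

section
/- Let N₁, N₂, N_p, L be positive integers, K ≥ 1 an integer, X ⊆ ℝ^{N₁} nonempty and compact, Y ⊆ ℝ^{N₂} nonempty and compact, Ξ ⊆ ℝ^{N_p} nonempty and compact, c ∈ ℝ^{N₁}, and let d, T, W, h be affine in ξ. Define Q_K(x, y, ξ) = min{⟨d(ξ), y_k⟩ : k ∈ {1,…,K}, T(ξ)x + W(ξ)y_k ≤ h(ξ)} ∈ EReal (equal to +∞ if no k is feasible) and Φ_K(x, y) = ⟨c,x⟩ + sup_{ξ∈Ξ} Q_K(x, y, ξ). Then Φ_K attains its infimum over X × Y^K: there exists (x*, y*) ∈ X × Y^K with Φ_K(x*, y*) ≤ Φ_K(x, y) for all (x, y) ∈ X × Y^K. In particular, the K-adaptability problem attains its infimum whenever it is feasible. (Proposition B.1(ii).) -/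
open Matrix

/-- A lower semicontinuous function, set to `⊤` off a closed set, is lower semicontinuous. -/
theorem lowerSemicontinuous_iInf_mem_of_isClosed {α β : Type*} [TopologicalSpace α]
    [CompleteLattice β] {f : α → β} {s : Set α}
    (hf : LowerSemicontinuous f) (hs : IsClosed s) :
    LowerSemicontinuous fun x => ⨅ _ : x ∈ s, f x := by
  intro x a ha
  by_cases hx : x ∈ s
  · have hfx : a < f x := by simpa [hx] using ha
    filter_upwards [hf x a hfx] with z hz
    exact hz.trans_le (le_iInf fun _ => le_rfl)
  · have htop : a < ⊤ := ha.trans_le le_top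
    filter_upwards [hs.isOpen_compl.mem_nhds hx] with z hz
    have hz' : z ∉ s := hz
    simpa [hz'] using htop

/-- A finite infimum of lower semicontinuous functions is lower semicontinuous. -/
theorem lowerSemicontinuous_iInf_of_finite {α β ι : Type*} [TopologicalSpace α]
    [CompleteLinearOrder β] [Finite ι] [Nonempty ι] {f : ι → α → β}
    (hf : ∀ i, LowerSemicontinuous (f i)) :
    LowerSemicontinuous fun x => ⨅ i, f i x := by
  intro x a ha
  have hev := Filter.eventually_all.2 fun i => hf i x a (ha.trans_le (iInf_le _ i))
  filter_upwards [hev] with z hz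
  obtain ⟨i, hi⟩ := exists_eq_ciInf_of_finite (f := fun i => f i z)
  exact (hz i).trans_eq hi

/-- Proposition B.1(ii): the `K`-adaptability objective
`Φ_K(x,y) = ⟨c,x⟩ + sup_{ξ∈Ξ} min{⟨d(ξ),y_k⟩ : T(ξ)x + W(ξ)y_k ≤ h(ξ)}`
attains its infimum over `X × Y^K` when `X`, `Y` and `Ξ` are nonempty and compact;
in particular, the `K`-adaptability problem attains its infimum whenever it is
feasible. -/
theorem stmt13 (N₁ N₂ Np L K : ℕ) (hN₁ : 0 < N₁) (hN₂ : 0 < N₂) (hNp : 0 < Np)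
    (hL : 0 < L) (hK : 1 ≤ K)
    (X : Set (Fin N₁ → ℝ)) (hXne : X.Nonempty) (hXc : IsCompact X)
    (Y : Set (Fin N₂ → ℝ)) (hYne : Y.Nonempty) (hYc : IsCompact Y)
    (Ξ : Set (Fin Np → ℝ)) (hΞne : Ξ.Nonempty) (hΞc : IsCompact Ξ)
    (c : Fin N₁ → ℝ)
    (d : (Fin Np → ℝ) → (Fin N₂ → ℝ))
    (T : (Fin Np → ℝ) → Matrix (Fin L) (Fin N₁) ℝ)
    (W : (Fin Np → ℝ) → Matrix (Fin L) (Fin N₂) ℝ)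
    (h : (Fin Np → ℝ) → (Fin L → ℝ))
    (hd : ∃ (d₀ : Fin N₂ → ℝ) (D : (Fin Np → ℝ) →ₗ[ℝ] (Fin N₂ → ℝ)), ∀ ξ, d ξ = d₀ + D ξ)
    (hT : ∃ (T₀ : Matrix (Fin L) (Fin N₁) ℝ)
      (Tl : (Fin Np → ℝ) →ₗ[ℝ] Matrix (Fin L) (Fin N₁) ℝ), ∀ ξ, T ξ = T₀ + Tl ξ)
    (hW : ∃ (W₀ : Matrix (Fin L) (Fin N₂) ℝ)
      (Wl : (Fin Np → ℝ) →ₗ[ℝ] Matrix (Fin L) (Fin N₂) ℝ), ∀ ξ, W ξ = W₀ + Wl ξ)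
    (hh : ∃ (h₀ : Fin L → ℝ) (hl : (Fin Np → ℝ) →ₗ[ℝ] (Fin L → ℝ)), ∀ ξ, h ξ = h₀ + hl ξ)
    (Φ : (Fin N₁ → ℝ) → (Fin K → Fin N₂ → ℝ) → EReal)
    (hΦ : ∀ x y, Φ x y = ((c ⬝ᵥ x : ℝ) : EReal) +
      ⨆ ξ ∈ Ξ, ⨅ k ∈ {k : Fin K | T ξ *ᵥ x + W ξ *ᵥ y k ≤ h ξ},
        ((d ξ ⬝ᵥ y k : ℝ) : EReal)) :
    ∃ xs ∈ X, ∃ ys ∈ {y : Fin K → Fin N₂ → ℝ | ∀ k, y k ∈ Y},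
      ∀ x ∈ X, ∀ y ∈ {y : Fin K → Fin N₂ → ℝ | ∀ k, y k ∈ Y}, Φ xs ys ≤ Φ x y := by
  have : Nonempty (Fin K) := ⟨⟨0, hK⟩⟩
  have hsup : LowerSemicontinuous fun p : (Fin N₁ → ℝ) × (Fin K → Fin N₂ → ℝ) =>
      ⨆ ξ ∈ Ξ, ⨅ k ∈ {k : Fin K | T ξ *ᵥ p.1 + W ξ *ᵥ p.2 k ≤ h ξ},
        ((d ξ ⬝ᵥ p.2 k : ℝ) : EReal) := by
    refine lowerSemicontinuous_biSup fun ξ _ => lowerSemicontinuous_iInf_of_finite fun k => ?_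
    have hval : Continuous fun p : (Fin N₁ → ℝ) × (Fin K → Fin N₂ → ℝ) =>
        ((d ξ ⬝ᵥ p.2 k : ℝ) : EReal) :=
      continuous_coe_real_ereal.comp (by fun_prop)
    have hfeas : IsClosed {p : (Fin N₁ → ℝ) × (Fin K → Fin N₂ → ℝ) |
        T ξ *ᵥ p.1 + W ξ *ᵥ p.2 k ≤ h ξ} :=
      isClosed_le (by fun_prop) continuous_const
    exact lowerSemicontinuous_iInf_mem_of_isClosed hval.lowerSemicontinuous hfeas
  have hcost : Continuous fun p : (Fin N₁ → ℝ) × (Fin K → Fin N₂ → ℝ) =>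
      ((c ⬝ᵥ p.1 : ℝ) : EReal) :=
    continuous_coe_real_ereal.comp (by fun_prop)
  have hlsc : LowerSemicontinuous fun p : (Fin N₁ → ℝ) × (Fin K → Fin N₂ → ℝ) =>
      Φ p.1 p.2 := by
    simp only [hΦ]
    exact hcost.lowerSemicontinuous.add' hsup fun p =>
      EReal.continuousAt_add (Or.inl (EReal.coe_ne_top _)) (Or.inl (EReal.coe_ne_bot _))
  have hYK : IsCompact {y : Fin K → Fin N₂ → ℝ | ∀ k, y k ∈ Y} :=
    isCompact_pi_infinite fun _ => hYc
  obtain ⟨x₀, hx₀⟩ := hXne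
  obtain ⟨y₀, hy₀⟩ := hYne
  obtain ⟨p, ⟨hpX, hpY⟩, hmin⟩ := (hlsc.lowerSemicontinuousOn _).exists_isMinOn
    (⟨(x₀, fun _ => y₀), hx₀, fun _ => hy₀⟩ :
      (X ×ˢ {y : Fin K → Fin N₂ → ℝ | ∀ k, y k ∈ Y}).Nonempty) (hXc.prod hYK)
  exact ⟨p.1, hpX, p.2, hpY, fun x hx y hy => hmin (Set.mk_mem_prod hx hy)⟩
end

section
/- Let n ≥ 1, ε ∈ (0, 1/2), let A be a real R×n matrix and b ∈ ℝ^R, and suppose Ξ = {ξ ∈ [0,1]^n : Aξ ≤ b} is nonempty. Set K = n + 1 and define triples (y_k⁰, ℓ_k, u_k) by (0, ε e_k, 𝟙 − ε e_k) for k = 1,…,n and (1, 0, 𝟙) for k = n+1, where e_k is the k-th unit vector and 𝟙 the all-ones vector. Then sup_{ξ ∈ Ξ} min{ y_k⁰ : k ∈ {1,…,n+1}, ℓ_k ≤ ξ ≤ u_k } = 1 if and only if there exists ξ ∈ ([0,ε) ∪ (1−ε, 1])^n with Aξ ≤ b. (This is the reduction underlying Proposition B.3(i), showing that evaluating the worst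 case of K fixed policies encodes the approximate 0/1 integer programming feasibility problem.) -/
open Matrix

/-- The reduction underlying Proposition B.3(i): with `K = n+1` policies
`(y_k⁰, ℓ_k, u_k) = (0, ε e_k, 𝟙 − ε e_k)` for `k = 1,…,n` and `(1, 0, 𝟙)` for
`k = n+1`, and `Ξ = {ξ ∈ [0,1]ⁿ : Aξ ≤ b}` nonempty,
`sup_{ξ∈Ξ} min{y_k⁰ : ℓ_k ≤ ξ ≤ u_k} = 1` if and only if there exists
`ξ ∈ ([0,ε) ∪ (1−ε,1])ⁿ` with `Aξ ≤ b` (approximate 0/1 IP feasibility). -/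
theorem stmt14 (n R : ℕ) (hn : 1 ≤ n) (ε : ℝ) (hε : ε ∈ Set.Ioo (0 : ℝ) (1 / 2))
    (A : Matrix (Fin R) (Fin n) ℝ) (b : Fin R → ℝ)
    (Ξ : Set (Fin n → ℝ))
    (hΞ : Ξ = {ξ | (∀ i, ξ i ∈ Set.Icc (0 : ℝ) 1) ∧ A *ᵥ ξ ≤ b})
    (hΞne : Ξ.Nonempty)
    (y0 : Fin (n + 1) → ℝ) (lo hi : Fin (n + 1) → Fin n → ℝ)
    (hcast : ∀ k : Fin n, y0 k.castSucc = 0 ∧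
      (∀ i, lo k.castSucc i = if i = k then ε else 0) ∧
      (∀ i, hi k.castSucc i = if i = k then 1 - ε else 1))
    (hlast : y0 (Fin.last n) = 1 ∧ (∀ i, lo (Fin.last n) i = 0) ∧
      (∀ i, hi (Fin.last n) i = 1)) :
    sSup ((fun ξ => sInf {v : ℝ | ∃ k : Fin (n + 1), lo k ≤ ξ ∧ ξ ≤ hi k ∧ v = y0 k})
        '' Ξ) = 1 ↔
      ∃ ξ : Fin n → ℝ,
        (∀ i, ξ i ∈ Set.Ico (0 : ℝ) ε ∪ Set.Ioc (1 - ε) 1) ∧ A *ᵥ ξ ≤ b := by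
  obtain ⟨hε0, hε2⟩ := hε
  obtain ⟨hy1, hl0, hl1⟩ := hlast
  subst hΞ
  set g : (Fin n → ℝ) → ℝ := fun ξ =>
    sInf {v : ℝ | ∃ k : Fin (n + 1), lo k ≤ ξ ∧ ξ ≤ hi k ∧ v = y0 k} with hg
  have hlast_mem : ∀ ξ : Fin n → ℝ, (∀ i, ξ i ∈ Set.Icc (0 : ℝ) 1) →
      lo (Fin.last n) ≤ ξ ∧ ξ ≤ hi (Fin.last n) := fun ξ hξ =>
    ⟨fun i => (hl0 i).trans_le (hξ i).1, fun i => (hξ i).2.trans_eq (hl1 i).symm⟩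
  have g_one : ∀ ξ : Fin n → ℝ, (∀ i, ξ i ∈ Set.Icc (0 : ℝ) 1) →
      (∀ i, ξ i ∈ Set.Ico (0 : ℝ) ε ∪ Set.Ioc (1 - ε) 1) → g ξ = 1 := by
    intro ξ hξ hgood
    refine IsLeast.csInf_eq ⟨⟨Fin.last n, (hlast_mem ξ hξ).1, (hlast_mem ξ hξ).2, hy1.symm⟩, ?_⟩
    rintro v ⟨k, hlk, hku, rfl⟩
    induction k using Fin.lastCases with
    | last => exact hy1.ge
    | cast k =>
      obtain ⟨-, hlo, hhi⟩ := hcast k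
      have h1 := hlk k
      have h2 := hku k
      rw [hlo, if_pos rfl] at h1
      rw [hhi, if_pos rfl] at h2
      rcases hgood k with h | h
      · exact absurd h.2 h1.not_gt
      · exact absurd h.1 h2.not_gt
  have g_zero : ∀ ξ : Fin n → ℝ, (∀ i, ξ i ∈ Set.Icc (0 : ℝ) 1) →
      ∀ k, ε ≤ ξ k → ξ k ≤ 1 - ε → g ξ = 0 := by
    intro ξ hξ k h1 h2
    obtain ⟨hy, hlo, hhi⟩ := hcast k
    refine IsLeast.csInf_eq ⟨⟨k.castSucc, fun i => ?_, fun i => ?_, hy.symm⟩, ?_⟩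
    · rw [hlo]
      split_ifs with h
      · exact h ▸ h1
      · exact (hξ i).1
    · rw [hhi]
      split_ifs with h
      · exact h ▸ h2
      · exact (hξ i).2
    · rintro v ⟨j, -, -, rfl⟩
      induction j using Fin.lastCases with
      | last => exact zero_le_one.trans_eq hy1.symm
      | cast j => exact (hcast j).1.ge
  have exists_mid : ∀ ξ : Fin n → ℝ, (∀ i, ξ i ∈ Set.Icc (0 : ℝ) 1) →
      (¬ ∀ i, ξ i ∈ Set.Ico (0 : ℝ) ε ∪ Set.Ioc (1 - ε) 1) →
      ∃ k, ε ≤ ξ k ∧ ξ k ≤ 1 - ε := by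
    intro ξ hξ hbad
    obtain ⟨k, hk⟩ := not_forall.mp hbad
    exact ⟨k, not_lt.mp fun h => hk (Or.inl ⟨(hξ k).1, h⟩),
      not_lt.mp fun h => hk (Or.inr ⟨h, (hξ k).2⟩)⟩
  constructor
  · intro hsup
    by_contra hno
    have hle : sSup (g '' {ξ | (∀ i, ξ i ∈ Set.Icc (0 : ℝ) 1) ∧ A *ᵥ ξ ≤ b}) ≤ 0 := by
      refine csSup_le (hΞne.image g) ?_
      rintro _ ⟨ξ, ⟨hξ, hA⟩, rfl⟩
      obtain ⟨k, h1, h2⟩ := exists_mid ξ hξ fun h => hno ⟨ξ, h, hA⟩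
      exact (g_zero ξ hξ k h1 h2).le
    linarith
  · rintro ⟨ξ, hgood, hA⟩
    have hξ : ∀ i, ξ i ∈ Set.Icc (0 : ℝ) 1 := by
      intro i
      rcases hgood i with h | h
      · exact ⟨h.1, by linarith [h.2]⟩
      · exact ⟨by linarith [h.1], h.2⟩
    refine IsGreatest.csSup_eq ⟨⟨ξ, ⟨hξ, hA⟩, g_one ξ hξ hgood⟩, ?_⟩
    rintro _ ⟨η, ⟨hη, -⟩, rfl⟩
    by_cases h : ∀ i, η i ∈ Set.Ico (0 : ℝ) ε ∪ Set.Ioc (1 - ε) 1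
    · exact (g_one η hη h).le
    · obtain ⟨k, h1, h2⟩ := exists_mid η hη h
      exact (g_zero η hη k h1 h2).trans_le zero_le_one
end

section
/- The following equalities hold: (a) inf_{y ∈ {−1,1}} sup_{ξ ∈ [−1,1]} ξ y = 1; (b) inf_{(y₁,y₂) ∈ {−1,1}×{−1,1}} sup_{ξ ∈ [−1,1]} min(ξ y₁, ξ y₂) = 0; (c) inf_{y ∈ [−1,1]} sup_{ξ ∈ [−1,1]} ξ y = 0. Hence the 1-adaptability value (a) strictly exceeds the static value over the convex hull (c), while the 2-adaptability value (b) equals it, confirming that the condition K > min{N₂, N_p} in the reduction of the K-adaptability problem to a static problem cannot be dropped. (This is the counterexample in the proof of Proposition B.4.) -/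
theorem isGreatest_mul_image_Icc (y : ℝ) :
    IsGreatest ((fun ξ => ξ * y) '' Set.Icc (-1 : ℝ) 1) |y| := by
  refine ⟨?_, ?_⟩
  · rcases le_total 0 y with h | h
    · exact ⟨1, by norm_num, by simp [abs_of_nonneg h]⟩
    · exact ⟨-1, by norm_num, by simp [abs_of_nonpos h]⟩
  · rintro _ ⟨ξ, hξ, rfl⟩
    calc ξ * y ≤ |ξ| * |y| := (le_abs_self _).trans_eq (abs_mul ξ y)
      _ ≤ |y| := mul_le_of_le_one_left (abs_nonneg y) (abs_le.mpr hξ)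

theorem isGreatest_min_mul_neg_image_Icc :
    IsGreatest ((fun ξ => min (ξ * (-1)) (ξ * 1)) '' Set.Icc (-1 : ℝ) 1) 0 := by
  refine ⟨⟨0, by norm_num, by norm_num⟩, ?_⟩
  rintro _ ⟨ξ, -, rfl⟩
  rcases le_total 0 ξ with h | h
  · exact (min_le_left _ _).trans (by linarith)
  · exact (min_le_right _ _).trans (by linarith)

theorem sSup_min_mul_image_Icc_nonneg (y₁ y₂ : ℝ) :
    0 ≤ sSup ((fun ξ => min (ξ * y₁) (ξ * y₂)) '' Set.Icc (-1 : ℝ) 1) := by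
  refine le_csSup ?_ ⟨0, by norm_num, by simp⟩
  exact isCompact_Icc.bddAbove_image (by fun_prop)

/-- Counterexample in the proof of Proposition B.4:
(a) `inf_{y∈{−1,1}} sup_{ξ∈[−1,1]} ξy = 1` (the 1-adaptability value),
(b) `inf_{(y₁,y₂)∈{−1,1}²} sup_{ξ∈[−1,1]} min(ξy₁, ξy₂) = 0` (the 2-adaptability value),
(c) `inf_{y∈[−1,1]} sup_{ξ∈[−1,1]} ξy = 0` (the static value over the convex hull);
hence the condition `K > min{N₂, N_p}` in the reduction of the `K`-adaptability problem
to a static problem cannot be dropped. -/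
theorem stmt16 :
    (sInf ((fun y => sSup ((fun ξ => ξ * y) '' Set.Icc (-1 : ℝ) 1)) ''
        ({-1, 1} : Set ℝ)) = 1) ∧
    (sInf {v : ℝ | ∃ y₁ ∈ ({-1, 1} : Set ℝ), ∃ y₂ ∈ ({-1, 1} : Set ℝ),
        v = sSup ((fun ξ => min (ξ * y₁) (ξ * y₂)) '' Set.Icc (-1 : ℝ) 1)} = 0) ∧
    (sInf ((fun y => sSup ((fun ξ => ξ * y) '' Set.Icc (-1 : ℝ) 1)) ''
        Set.Icc (-1 : ℝ) 1) = 0) := by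
  simp only [(isGreatest_mul_image_Icc _).csSup_eq]
  refine ⟨by simp [Set.image_pair], IsLeast.csInf_eq ⟨?_, ?_⟩, IsLeast.csInf_eq ⟨?_, ?_⟩⟩
  · exact ⟨-1, by simp, 1, by simp, isGreatest_min_mul_neg_image_Icc.csSup_eq.symm⟩
  · rintro _ ⟨y₁, -, y₂, -, rfl⟩
    exact sSup_min_mul_image_Icc_nonneg y₁ y₂
  · exact ⟨0, by norm_num, abs_zero⟩
  · rintro _ ⟨y, -, rfl⟩
    exact abs_nonneg y
end

section
/- Let N₁, N₂, N_p, L be positive integers, K ≥ 1 an integer, X ⊆ ℝ^{N₁} nonempty and compact, Y ⊆ ℝ^{N₂} nonempty, compact and convex, Ξ ⊆ ℝ^{N_p} nonempty, compact and convex, c ∈ ℝ^{N₁}, d : ℝ^{N_p} → ℝ^{N₂} affine, and T ∈ ℝ^{L×N₁}, W ∈ ℝ^{L×N₂}, h ∈ ℝ^L fixed (deterministic constraints). Then the K-adaptability value equals the two-stage robust optimization value: inf_{x∈X, (y₁,…,y_K)∈Y^K} sup_{ξ∈Ξ} min{⟨c,x⟩ + ⟨d(ξ), y_k⟩ : k ∈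 {1,…,K}, Tx + Wy_k ≤ h} = inf_{x∈X} sup_{ξ∈Ξ} inf{⟨c,x⟩ + ⟨d(ξ), y⟩ : y ∈ Y, Tx + Wy ≤ h}. (Proposition B.5(i): when Y and Ξ are convex and only the objective function is uncertain, the optimal values of the two-stage robust optimization problem and the K-adaptability problem coincide, irrespective of X and K.) -/
open Matrix

/-- An objective that is affine in the decision and affine in the parameter has a saddle point
over nonempty compact convex sets. -/
theorem exists_isSaddlePointOn_affine_dotProduct {m n : ℕ} {F : Set (Fin n → ℝ)}
    (hFne : F.Nonempty) (hFconv : Convex ℝ F) (hFc : IsCompact F)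
    {Ξ : Set (Fin m → ℝ)} (hΞne : Ξ.Nonempty) (hΞconv : Convex ℝ Ξ) (hΞc : IsCompact Ξ)
    (r : ℝ) (d₀ : Fin n → ℝ) (D : (Fin m → ℝ) →ₗ[ℝ] (Fin n → ℝ)) :
    ∃ a ∈ F, ∃ b ∈ Ξ, IsSaddlePointOn F Ξ (fun y ξ => r + (d₀ + D ξ) ⬝ᵥ y) a b := by
  have hD : Continuous D := D.continuous_of_finiteDimensional
  refine Sion.exists_isSaddlePointOn hFne hFconv hFc (fun ξ _ => ?_) (fun ξ _ => ?_)
    hΞconv hΞne hΞc (fun y _ => ?_) (fun y _ => ?_)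
  · exact Continuous.lowerSemicontinuous (by fun_prop) |>.lowerSemicontinuousOn _
  · refine ConvexOn.quasiconvexOn ⟨hFconv, fun u _ v _ s t _ _ hst => le_of_eq ?_⟩
    simp only [dotProduct_add, dotProduct_smul, smul_eq_mul]
    linear_combination (-r) * hst
  · exact Continuous.upperSemicontinuous (by fun_prop) |>.upperSemicontinuousOn _
  · refine ConcaveOn.quasiconcaveOn ⟨hΞconv, fun u _ v _ s t _ _ hst => le_of_eq ?_⟩
    simp only [map_add, map_smul, add_dotProduct, smul_dotProduct, smul_eq_mul]
    linear_combination (r + d₀ ⬝ᵥ y) * hst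

/-- Proposition B.5(i): when `Y` and `Ξ` are convex (and compact) and only the objective
function is uncertain (affine `d`, deterministic constraints), the optimal values of the
`K`-adaptability problem and the two-stage robust optimization problem coincide,
irrespective of `X` and `K`. -/
theorem stmt17 (N₁ N₂ Np L K : ℕ) (hN₁ : 0 < N₁) (hN₂ : 0 < N₂) (hNp : 0 < Np)
    (hL : 0 < L) (hK : 1 ≤ K)
    (X : Set (Fin N₁ → ℝ)) (hXne : X.Nonempty) (hXc : IsCompact X)
    (Y : Set (Fin N₂ → ℝ)) (hYne : Y.Nonempty) (hYc : IsCompact Y) (hYconv : Convex ℝ Y)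
    (Ξ : Set (Fin Np → ℝ)) (hΞne : Ξ.Nonempty) (hΞc : IsCompact Ξ) (hΞconv : Convex ℝ Ξ)
    (c : Fin N₁ → ℝ)
    (d : (Fin Np → ℝ) → (Fin N₂ → ℝ))
    (hd : ∃ (d₀ : Fin N₂ → ℝ) (D : (Fin Np → ℝ) →ₗ[ℝ] (Fin N₂ → ℝ)), ∀ ξ, d ξ = d₀ + D ξ)
    (T : Matrix (Fin L) (Fin N₁) ℝ) (W : Matrix (Fin L) (Fin N₂) ℝ) (h : Fin L → ℝ) :
    (⨅ x ∈ X, ⨅ y ∈ {y : Fin K → Fin N₂ → ℝ | ∀ k, y k ∈ Y}, ⨆ ξ ∈ Ξ,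
        ⨅ k ∈ {k : Fin K | T *ᵥ x + W *ᵥ y k ≤ h},
          ((c ⬝ᵥ x + d ξ ⬝ᵥ y k : ℝ) : EReal)) =
      ⨅ x ∈ X, ⨆ ξ ∈ Ξ, ⨅ y ∈ {y ∈ Y | T *ᵥ x + W *ᵥ y ≤ h},
        ((c ⬝ᵥ x + d ξ ⬝ᵥ y : ℝ) : EReal) := by
  obtain ⟨d₀, D, hd⟩ := hd
  refine biInf_congr fun x _ => le_antisymm ?_ ?_
  · set F : Set (Fin N₂ → ℝ) := {y ∈ Y | T *ᵥ x + W *ᵥ y ≤ h} with hF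
    rcases F.eq_empty_or_nonempty with hFe | hFne
    · obtain ⟨ξ, hξ⟩ := hΞne
      exact le_iSup₂_of_le ξ hξ (by simp [hFe])
    have hFconv : Convex ℝ F := by
      refine hYconv.inter fun u hu v hv s t hs ht hst i => ?_
      have hui : (T *ᵥ x) i + (W *ᵥ u) i ≤ h i := hu i
      have hvi : (T *ᵥ x) i + (W *ᵥ v) i ≤ h i := hv i
      simp only [mulVec_add, mulVec_smul, Pi.add_apply, Pi.smul_apply, smul_eq_mul]
      calc (T *ᵥ x) i + (s * (W *ᵥ u) i + t * (W *ᵥ v) i)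
          = s * ((T *ᵥ x) i + (W *ᵥ u) i) + t * ((T *ᵥ x) i + (W *ᵥ v) i) := by
            linear_combination (-(T *ᵥ x) i) * hst
        _ ≤ s * h i + t * h i := by gcongr
        _ = h i := by rw [← add_mul, hst, one_mul]
    have hFc : IsCompact F :=
      hYc.inter_right <| isClosed_le (f := fun y => T *ᵥ x + W *ᵥ y) (g := fun _ => h)
        (continuous_const.add (continuous_const.matrix_mulVec continuous_id)) continuous_const
    obtain ⟨a, ha, b, hb, hab⟩ := exists_isSaddlePointOn_affine_dotProduct
      hFne hFconv hFc hΞne hΞconv hΞc (c ⬝ᵥ x) d₀ D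
    refine iInf₂_le_of_le (fun _ => a) (fun _ => ha.1) (iSup₂_le fun ξ hξ => ?_)
    refine le_iSup₂_of_le b hb (le_iInf₂ fun y hy => iInf₂_le_of_le ⟨0, hK⟩ ha.2 ?_)
    rw [hd ξ, hd b]
    exact EReal.coe_le_coe (hab y hy ξ hξ)
  · exact le_iInf₂ fun y hy => iSup₂_mono fun ξ _ =>
      le_iInf₂ fun k hk => iInf₂_le (y k) ⟨hy k, hk⟩
end

section
/- Let N₁, N₂, N_p, L be positive integers, X ⊆ ℝ^{N₁} nonempty, Ξ ⊆ ℝ^{N_p} nonempty, c ∈ ℝ^{N₁}, and let d : ℝ^{N_p} → ℝ^{N₂}, T : ℝ^{N_p} → ℝ^{L×N₁}, W : ℝ^{N_p} → ℝ^{L×N₂}, h : ℝ^{N_p} → ℝ^L be affine. Suppose Y ⊆ ℝ^{N₂} is a nonempty finite set and K ≥ |Y|. Then the K-adaptability value equals the two-stage robust optimization value: inf_{x∈X, (y₁,…,y_K)∈Y^K} sup_{ξ∈Ξ} min{⟨c,x⟩ + ⟨d(ξ), y_k⟩ : k ∈ {1,…,K}, T(ξ)x + W(ξ)y_k ≤ h(ξ)}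 = inf_{x∈X} sup_{ξ∈Ξ} inf{⟨c,x⟩ + ⟨d(ξ), y⟩ : y ∈ Y, T(ξ)x + W(ξ)y ≤ h(ξ)}. (Proposition B.5(iii): if the recourse set has finite cardinality and K is at least this cardinality, the optimal values of the two-stage robust optimization problem and the K-adaptability problem coincide, irrespective of X and Ξ.) -/
open Matrix

/-- A nonempty finite set of cardinality at most `K` is the range of a family indexed by
`Fin K`. -/
theorem Set.Finite.exists_fin_range_eq {α : Type*} {s : Set α} (hs : s.Finite)
    (hne : s.Nonempty) {K : ℕ} (hK : s.ncard ≤ K) : ∃ y : Fin K → α, Set.range y = s := by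
  have := hs.fintype
  have := hne.to_subtype
  have hcard : Fintype.card s ≤ Fintype.card (Fin K) := by
    rwa [Fintype.card_fin, ← Nat.card_eq_fintype_card, Nat.card_coe_set_eq]
  obtain ⟨f⟩ := Function.Embedding.nonempty_of_card_le hcard
  refine ⟨Subtype.val ∘ Function.invFun f, ?_⟩
  rw [(Function.invFun_surjective f.injective).range_comp, Subtype.range_coe]

/-- Proposition B.5(iii): if the recourse set `Y` is a nonempty finite set and
`K ≥ |Y|`, then the optimal values of the `K`-adaptability problem and the two-stage
robust optimization problem coincide, irrespective of `X` and `Ξ` (with affine `d`,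
`T`, `W`, `h`; values in `EReal`, infima/minima over empty sets equal `+∞`). -/
theorem stmt18 (N₁ N₂ Np L K : ℕ) (hN₁ : 0 < N₁) (hN₂ : 0 < N₂) (hNp : 0 < Np)
    (hL : 0 < L)
    (X : Set (Fin N₁ → ℝ)) (hXne : X.Nonempty)
    (Ξ : Set (Fin Np → ℝ)) (hΞne : Ξ.Nonempty)
    (Y : Set (Fin N₂ → ℝ)) (hYne : Y.Nonempty) (hYfin : Y.Finite)
    (hK : Y.ncard ≤ K)
    (c : Fin N₁ → ℝ)
    (d : (Fin Np → ℝ) → (Fin N₂ → ℝ))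
    (T : (Fin Np → ℝ) → Matrix (Fin L) (Fin N₁) ℝ)
    (W : (Fin Np → ℝ) → Matrix (Fin L) (Fin N₂) ℝ)
    (h : (Fin Np → ℝ) → (Fin L → ℝ))
    (hd : ∃ (d₀ : Fin N₂ → ℝ) (D : (Fin Np → ℝ) →ₗ[ℝ] (Fin N₂ → ℝ)), ∀ ξ, d ξ = d₀ + D ξ)
    (hT : ∃ (T₀ : Matrix (Fin L) (Fin N₁) ℝ)
      (Tl : (Fin Np → ℝ) →ₗ[ℝ] Matrix (Fin L) (Fin N₁) ℝ), ∀ ξ, T ξ = T₀ + Tl ξ)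
    (hW : ∃ (W₀ : Matrix (Fin L) (Fin N₂) ℝ)
      (Wl : (Fin Np → ℝ) →ₗ[ℝ] Matrix (Fin L) (Fin N₂) ℝ), ∀ ξ, W ξ = W₀ + Wl ξ)
    (hh : ∃ (h₀ : Fin L → ℝ) (hl : (Fin Np → ℝ) →ₗ[ℝ] (Fin L → ℝ)), ∀ ξ, h ξ = h₀ + hl ξ) :
    (⨅ x ∈ X, ⨅ y ∈ {y : Fin K → Fin N₂ → ℝ | ∀ k, y k ∈ Y}, ⨆ ξ ∈ Ξ,
        ⨅ k ∈ {k : Fin K | T ξ *ᵥ x + W ξ *ᵥ y k ≤ h ξ},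
          ((c ⬝ᵥ x + d ξ ⬝ᵥ y k : ℝ) : EReal)) =
      ⨅ x ∈ X, ⨆ ξ ∈ Ξ, ⨅ y ∈ {y ∈ Y | T ξ *ᵥ x + W ξ *ᵥ y ≤ h ξ},
        ((c ⬝ᵥ x + d ξ ⬝ᵥ y : ℝ) : EReal) := by
  refine iInf_congr fun x => iInf_congr fun _ => le_antisymm ?_ ?_
  · obtain ⟨y, rfl⟩ := hYfin.exists_fin_range_eq hYne hK
    refine iInf₂_le_of_le y (fun k => Set.mem_range_self k) (iSup₂_mono fun ξ _ => le_iInf₂ ?_)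
    rintro _ ⟨⟨k, rfl⟩, hk⟩
    exact iInf₂_le k hk
  · exact le_iInf₂ fun y hy => iSup₂_mono fun ξ _ => le_iInf₂ fun k hk =>
      iInf₂_le (y k) ⟨hy k, hk⟩
end
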